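/- Assume Δ_{k−1} ≠ 0 and Δ_k = Δ_{k+1} = ⋯ = Δ_{n−1} = 0 for some n > k ≥ 1, let π_k be the unique monic formal orthogonal polynomial of degree k with respect to L, and let p_n be a monic polynomial of degree n that is quasi-orthogonal of order n−k with respect to L (so p_n = π_k · q for some monic polynomial q of degree n−k). Let λ_1,…,λ_ℓ be the distinct roots of p_n with multiplicities s_1,…,s_ℓ, and for 1 ≤ i ≤ ℓ let σ_i be the multiplicity of λ_i as a root of π_k (σ_i = 0 if λ_i is not a root of π_k). Then the interpolatory quadrature determined by p_n coincides with the interpolatory quadrature determined by π_k: its weights satisfy ω^{(n)}_{i,j} = 0 whenever j ≥ σ_i, and ω^{(n)}_{i,j} = ω^{(k)}_{i,j} whenever 0 ≤ j ≤ σ_i−1, where ω^{(k)}_{i,j} are the weights of the interpolatory quadrature determined by π_k. -/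

import Mathlib

open Polynomial Matrix

/-- `hankelDet m k` is the determinant of the `k × k` Hankel matrix with `(i,j)` entry
`m (i + j)` (0-indexed), i.e. the determinant `Δ_{k-1}` of the paper
(with `hankelDet m 0 = Δ_{-1} = 1`). -/
noncomputable def hankelDet (m : ℕ → ℂ) (k : ℕ) : ℂ :=
  (Matrix.of fun i j : Fin k => m ((i : ℕ) + (j : ℕ))).det

theorem aux_sum (L : Polynomial ℂ →ₗ[ℂ] ℂ) (g f : Polynomial ℂ) (N : ℕ)
    (hf : f.degree < (N : WithBot ℕ)) (t : ℕ) :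
    L (g * f * X ^ t) = ∑ i ∈ Finset.range N, f.coeff i * L (g * X ^ (i + t)) := by
  rcases Nat.eq_zero_or_pos N with rfl | hN
  · have : f = 0 := by
      rw [← Polynomial.degree_eq_bot]
      exact (Nat.WithBot.lt_zero_iff).1 (by simpa using hf)
    simp [this]
  have hnd : f.natDegree < N := by
    by_cases h0 : f = 0
    · simpa [h0] using hN
    · exact (Polynomial.natDegree_lt_iff_degree_lt h0).2 hf
  conv_lhs => rw [Polynomial.as_sum_range_C_mul_X_pow' f hnd]
  rw [Finset.mul_sum, Finset.sum_mul, map_sum]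
  refine Finset.sum_congr rfl fun i _ => ?_
  have : g * (C (f.coeff i) * X ^ i) * X ^ t = f.coeff i • (g * X ^ (i + t)) := by
    rw [Polynomial.smul_eq_C_mul]; ring
  rw [this, map_smul, smul_eq_mul]

theorem aux_nonsing (L : Polynomial ℂ →ₗ[ℂ] ℂ) (m : ℕ → ℂ) (hm : ∀ i, m i = L (X ^ i))
    (k : ℕ) (hΔ : hankelDet m k ≠ 0) (r : Polynomial ℂ) (hr : r.degree < (k : WithBot ℕ))
    (h0 : ∀ t < k, L (r * X ^ t) = 0) : r = 0 := by
  by_contra hne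
  apply hΔ
  unfold hankelDet
  rw [← Matrix.exists_mulVec_eq_zero_iff]
  refine ⟨fun i => r.coeff i, ?_, ?_⟩
  · intro hv
    apply hne
    ext i
    by_cases hi : i < k
    · simpa using congrFun hv ⟨i, hi⟩
    · rw [Polynomial.coeff_zero]
      exact Polynomial.coeff_eq_zero_of_degree_lt
        (lt_of_lt_of_le hr (by exact_mod_cast not_lt.1 hi))
  · ext t
    have h1 := aux_sum L 1 r k hr t
    rw [one_mul, h0 t t.2] at h1
    simp only [Matrix.mulVec, dotProduct, Matrix.of_apply, Pi.zero_apply]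
    rw [h1, ← Fin.sum_univ_eq_sum_range (fun i => r.coeff i * L (1 * X ^ (i + (t : ℕ)))) k]
    refine Finset.sum_congr rfl fun i _ => ?_
    rw [hm, one_mul, mul_comm, add_comm]

theorem aux_sing (L : Polynomial ℂ →ₗ[ℂ] ℂ) (m : ℕ → ℂ) (hm : ∀ i, m i = L (X ^ i))
    (N : ℕ) (hΔ : hankelDet m N = 0) : ∃ f : Polynomial ℂ, f ≠ 0 ∧
    f.degree < (N : WithBot ℕ) ∧ ∀ t < N, L (f * X ^ t) = 0 := by
  unfold hankelDet at hΔ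
  rw [← Matrix.exists_mulVec_eq_zero_iff] at hΔ
  obtain ⟨v, hv, hmv⟩ := hΔ
  set f : Polynomial ℂ := ∑ i : Fin N, C (v i) * X ^ (i : ℕ) with hf
  have hdeg : f.degree < (N : WithBot ℕ) := by
    exact Polynomial.degree_sum_fin_lt v
  have hco : ∀ i : Fin N, f.coeff i = v i := by
    intro i
    simp [hf, Polynomial.coeff_X_pow, Fin.val_inj]
  refine ⟨f, ?_, hdeg, ?_⟩
  · intro h0
    apply hv
    ext i
    rw [← hco i, h0]; simp
  · intro t ht
    have h1 := aux_sum L 1 f N hdeg t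
    rw [one_mul] at h1
    rw [h1, ← Fin.sum_univ_eq_sum_range (fun i => f.coeff i * L (1 * X ^ (i + (t : ℕ)))) N]
    have h2 := congrFun hmv ⟨t, ht⟩
    simp only [Matrix.mulVec, dotProduct, Matrix.of_apply, Pi.zero_apply] at h2
    rw [← h2]
    refine Finset.sum_congr rfl fun i _ => ?_
    rw [hm, hco, one_mul, mul_comm, add_comm]

theorem aux_zero (L : Polynomial ℂ →ₗ[ℂ] ℂ) (g q : Polynomial ℂ) (N t : ℕ)
    (hg : ∀ j < N, L (g * X ^ j) = 0) (hq : q = 0 ∨ q.natDegree + t < N) :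
    L (g * q * X ^ t) = 0 := by
  rcases hq with rfl | hq
  · simp
  · rw [aux_sum L g q (q.natDegree + 1)
      (lt_of_le_of_lt Polynomial.degree_le_natDegree (by exact_mod_cast Nat.lt_succ_self _))]
    refine Finset.sum_eq_zero fun i hi => ?_
    rw [Finset.mem_range] at hi
    rw [hg _ (by omega), mul_zero]

/-- If `f` has degree at most `k + d` and is orthogonal to low degrees, `π ∣ f`. -/
theorem aux_dvd (L : Polynomial ℂ →ₗ[ℂ] ℂ) (m : ℕ → ℂ) (hm : ∀ i, m i = L (X ^ i))
    (k : ℕ) (hΔ : hankelDet m k ≠ 0)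
    (π : Polynomial ℂ) (hπmonic : π.Monic) (hπdeg : π.natDegree = k)
    (N : ℕ) (hN : ∀ t < N, L (π * X ^ t) = 0)
    (f : Polynomial ℂ) (hf : f.natDegree ≤ N) (hf2 : k ≤ N)
    (h0 : ∀ t < k, L (f * X ^ t) = 0) : π * (f /ₘ π) = f := by
  have hdec := Polynomial.modByMonic_add_div f π
  have hr : (f %ₘ π) = 0 := by
    apply aux_nonsing L m hm k hΔ
    · have := Polynomial.degree_modByMonic_lt f hπmonic
      rwa [Polynomial.degree_eq_natDegree hπmonic.ne_zero, hπdeg] at this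
    · intro t ht
      have h1 : L (π * (f /ₘ π) * X ^ t) = 0 := by
        apply aux_zero L π _ N t hN
        right
        rw [Polynomial.natDegree_divByMonic f hπmonic, hπdeg]
        omega
      have h2 : f %ₘ π = f - π * (f /ₘ π) := by rw [eq_sub_iff_add_eq, hdec]
      rw [h2, sub_mul, map_sub, h0 t ht, h1, sub_zero]
  rw [hr, zero_add] at hdec
  exact hdec

theorem aux_orth (L : Polynomial ℂ →ₗ[ℂ] ℂ) (m : ℕ → ℂ) (hm : ∀ i, m i = L (X ^ i))
    (k n : ℕ) (hΔ : hankelDet m k ≠ 0)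
    (hzeros : ∀ t, k < t → t ≤ n → hankelDet m t = 0)
    (π : Polynomial ℂ) (hπmonic : π.Monic) (hπdeg : π.natDegree = k)
    (hFOP : ∀ t < k, L (π * X ^ t) = 0) (t : ℕ) (htn : t < n) :
    L (π * X ^ t) = 0 := by
  induction t using Nat.strong_induction_on with
  | _ t ih =>
  by_cases htk : t < k
  · exact hFOP t htk
  by_contra hc
  have hN : ∀ j < t, L (π * X ^ j) = 0 := fun j hj => ih j hj (by omega)
  obtain ⟨f, hf0, hfdeg, hforth⟩ := aux_sing L m hm (t + 1) (hzeros (t + 1) (by omega) (by omega))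
  have hfn : f.natDegree < t + 1 := (Polynomial.natDegree_lt_iff_degree_lt hf0).2 hfdeg
  have hdv := aux_dvd L m hm k hΔ π hπmonic hπdeg t hN f (by omega) (by omega)
    (fun j hj => hforth j (by omega))
  have hqd := Polynomial.natDegree_divByMonic f hπmonic
  set q := f /ₘ π with hq
  have hq0 : q ≠ 0 := by
    rintro h0
    rw [h0, mul_zero] at hdv
    exact hf0 hdv.symm
  have hqt : q.natDegree ≤ t := by omega
  have h1 := hforth (t - q.natDegree) (by omega)
  rw [← hdv, aux_sum L π q (q.natDegree + 1)
      (lt_of_le_of_lt Polynomial.degree_le_natDegree (by exact_mod_cast Nat.lt_succ_self _)),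
      Finset.sum_range_succ, Finset.sum_eq_zero, zero_add] at h1
  · rw [show q.natDegree + (t - q.natDegree) = t by omega] at h1
    rcases mul_eq_zero.1 h1 with h2 | h2
    · exact hq0 (Polynomial.leadingCoeff_eq_zero.1 h2)
    · exact hc h2
  · intro i hi
    rw [Finset.mem_range] at hi
    rw [hN _ (by omega), mul_zero]

theorem aux_herm (π f : Polynomial ℂ) (hπ : π ≠ 0)
    (hv : ∀ a : ℂ, ∀ t < π.rootMultiplicity a, (Polynomial.derivative^[t] f).eval a = 0) :
    π ∣ f := by
  by_cases hf : f = 0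
  · simp [hf]
  rw [(IsAlgClosed.splits π).dvd_iff_roots_le_roots hπ hf]
  rw [Multiset.le_iff_count]
  intro a
  rw [Polynomial.count_roots, Polynomial.count_roots]
  rcases Nat.eq_zero_or_pos (π.rootMultiplicity a) with h0 | h0
  · omega
  · have := (Polynomial.lt_rootMultiplicity_iff_isRoot_iterate_derivative
      (n := π.rootMultiplicity a - 1) (t := a) hf).2 (fun t ht => hv a t (by omega))
    omega

/-- Assume `Δ_{k−1} ≠ 0`, `Δ_k = ⋯ = Δ_{n−1} = 0` (`n > k ≥ 1`),
let `π_k` be the unique monic FOP of degree `k` and let `p_n` be a monic polynomial of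
degree `n` quasi-orthogonal of order `n − k`. Let `λ_1, …, λ_ℓ` be the distinct roots of
`p_n` with multiplicities `s_i`, and `σ_i` the multiplicity of `λ_i` as a root of `π_k`.
Then the interpolatory quadrature determined by `p_n` (weights `ω^{(n)}_{i,j} = L(h_{i,j})`,
`h` the Hermite basis of degree `< n`) coincides with the one determined by `π_k`
(weights `ω^{(k)}_{i,j} = L(H_{i,j})`, `H` the Hermite basis of degree `< k` for the nodes
with `σ_i ≥ 1`): `ω^{(n)}_{i,j} = 0` for `σ_i ≤ j < s_i`, and `ω^{(n)}_{i,j} = ω^{(k)}_{i,j}`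
for `0 ≤ j < σ_i`. -/
theorem stmt10 (L : Polynomial ℂ →ₗ[ℂ] ℂ) (m : ℕ → ℂ) (hm : ∀ i, m i = L (X ^ i))
    (k n : ℕ) (hk : 1 ≤ k) (hkn : k < n)
    (hΔ : hankelDet m k ≠ 0)
    (hzeros : ∀ t, k < t → t ≤ n → hankelDet m t = 0)
    (π : Polynomial ℂ) (hπmonic : π.Monic) (hπdeg : π.natDegree = k)
    (hFOP : ∀ t < k, L (π * X ^ t) = 0)
    (ℓ : ℕ) (node : Fin ℓ → ℂ) (s : Fin ℓ → ℕ)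
    (hinj : Function.Injective node) (hs : ∀ i, 1 ≤ s i) (hsum : ∑ i, s i = n)
    (p : Polynomial ℂ) (hp : p = ∏ i, (X - C (node i)) ^ s i)
    (hquasi : ∀ t < k, L (p * X ^ t) = 0)
    (h : Fin ℓ → ℕ → Polynomial ℂ)
    (hhdeg : ∀ (i : Fin ℓ) (j : ℕ), j < s i → (h i j).degree < (n : WithBot ℕ))
    (hherm : ∀ (i : Fin ℓ) (j : ℕ), j < s i → ∀ (r : Fin ℓ) (t : ℕ), t < s r →
      (Polynomial.derivative^[t] (h i j)).eval (node r) = if r = i ∧ t = j then 1 else 0)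
    (H : Fin ℓ → ℕ → Polynomial ℂ)
    (hHdeg : ∀ (i : Fin ℓ) (j : ℕ), j < π.rootMultiplicity (node i) →
      (H i j).degree < (k : WithBot ℕ))
    (hHherm : ∀ (i : Fin ℓ) (j : ℕ), j < π.rootMultiplicity (node i) →
      ∀ (r : Fin ℓ) (t : ℕ), t < π.rootMultiplicity (node r) →
        (Polynomial.derivative^[t] (H i j)).eval (node r) = if r = i ∧ t = j then 1 else 0) :
    (∀ (i : Fin ℓ) (j : ℕ), π.rootMultiplicity (node i) ≤ j → j < s i → L (h i j) = 0) ∧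
    (∀ (i : Fin ℓ) (j : ℕ), j < π.rootMultiplicity (node i) → L (h i j) = L (H i j)) := by
  have hπ0 := hπmonic.ne_zero
  have horth := aux_orth L m hm k n hΔ hzeros π hπmonic hπdeg hFOP
  have hpdeg : p.natDegree = n := by
    rw [hp, Polynomial.natDegree_prod_of_monic _ _
      (fun i _ => (Polynomial.monic_X_sub_C _).pow _), ← hsum]
    simp
  have hpm : p.Monic := by
    rw [hp]
    exact Polynomial.monic_prod_of_monic _ _ (fun i _ => (Polynomial.monic_X_sub_C _).pow _)
  have hpdvd : π ∣ p := ⟨_, (aux_dvd L m hm k hΔ π hπmonic hπdeg n horth p hpdeg.le hkn.le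
    hquasi).symm⟩
  have hnodes : ∀ a : ℂ, 0 < π.rootMultiplicity a → ∃ i, node i = a := by
    intro a ha
    have h1 : p.IsRoot a := ((Polynomial.rootMultiplicity_pos hπ0).1 ha).dvd hpdvd
    rw [Polynomial.IsRoot.def, hp, Polynomial.eval_prod, Finset.prod_eq_zero_iff] at h1
    obtain ⟨i, _, hi⟩ := h1
    refine ⟨i, ?_⟩
    have := eq_zero_of_pow_eq_zero (by simpa using hi : (a - node i) ^ s i = 0)
    exact (sub_eq_zero.1 this).symm
  have hmult : ∀ i, p.rootMultiplicity (node i) = s i := by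
    intro i
    rw [← Polynomial.count_roots, hp, Polynomial.roots_prod _ _
      (Finset.prod_ne_zero_iff.2 fun i _ => pow_ne_zero _ (Polynomial.X_sub_C_ne_zero _))]
    simp [Multiset.count_bind, Multiset.count_singleton, hinj.eq_iff, List.sum_ofFn]
  have hle : ∀ i, π.rootMultiplicity (node i) ≤ s i := by
    intro i
    rw [← hmult i]
    exact Polynomial.rootMultiplicity_le_rootMultiplicity_of_dvd hpm.ne_zero hpdvd _
  have key : ∀ f : Polynomial ℂ, f.degree < (n : WithBot ℕ) →
      (∀ (r : Fin ℓ) (t : ℕ), t < π.rootMultiplicity (node r) →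
        (Polynomial.derivative^[t] f).eval (node r) = 0) → L f = 0 := by
    intro f hf hv
    have hd : π ∣ f := by
      apply aux_herm π f hπ0
      intro a t ht
      obtain ⟨i, rfl⟩ := hnodes a (by omega)
      exact hv i t ht
    obtain ⟨q, rfl⟩ := hd
    have := aux_zero L π q n 0 horth (by
      by_cases hq : q = 0
      · exact Or.inl hq
      · right
        have h1 := (Polynomial.natDegree_lt_iff_degree_lt (mul_ne_zero hπ0 hq)).2 hf
        rw [Polynomial.natDegree_mul hπ0 hq] at h1
        omega)
    simpa using this
  constructor
  · intro i j hj hjs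
    apply key _ (hhdeg i j hjs)
    intro r t ht
    rw [hherm i j hjs r t (lt_of_lt_of_le ht (hle r)), if_neg]
    rintro ⟨rfl, rfl⟩
    omega
  · intro i j hj
    have hjs := lt_of_lt_of_le hj (hle i)
    rw [← sub_eq_zero, ← map_sub]
    apply key
    · refine lt_of_le_of_lt (Polynomial.degree_sub_le _ _) (max_lt (hhdeg i j hjs) ?_)
      exact lt_trans (hHdeg i j hj) (by exact_mod_cast hkn)
    · intro r t ht
      rw [Polynomial.iterate_derivative_sub, Polynomial.eval_sub,
        hherm i j hjs r t (lt_of_lt_of_le ht (hle r)), hHherm i j hj r t ht, sub_self]
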